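/- Let M be an integer matrix and let S be a minimal torsion cocycle of M. Then no row of the submatrix M_S has exactly one nonzero entry with that entry equal to 1 or to -1. -/

import Mathlib

/-- The submatrix of `M` consisting of the columns indexed by `S`. -/
def colSubmatrix {m n : ℕ} (M : Matrix (Fin m) (Fin n) ℤ) (S : Finset (Fin n)) :
    Matrix (Fin m) {j // j ∈ S} ℤ :=
  M.submatrix id (fun j => (j : Fin n))

/-- `S` is a torsion cocycle of `M` if there is a prime `q` such that the rank of `M_S`
over `ℚ` is strictly greater than the rank of `M_S` reduced mod `q` over `ℤ/qℤ`. -/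
def IsTorsionCocycle {m n : ℕ} (M : Matrix (Fin m) (Fin n) ℤ) (S : Finset (Fin n)) : Prop :=
  ∃ q : ℕ, q.Prime ∧
    ((colSubmatrix M S).map (Int.cast : ℤ → ZMod q)).rank <
      ((colSubmatrix M S).map (Int.cast : ℤ → ℚ)).rank

/-- `S` is a minimal torsion cocycle of `M` if it is a torsion cocycle and no proper subset
of `S` is a torsion cocycle. -/
def IsMinimalTorsionCocycle {m n : ℕ} (M : Matrix (Fin m) (Fin n) ℤ) (S : Finset (Fin n)) :
    Prop :=
  IsTorsionCocycle M S ∧ ∀ T ⊂ S, ¬ IsTorsionCocycle M T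

/-- The rank of a set of columns of an integer matrix over a field `K` is the dimension of
their span. -/
theorem rank_colSubmatrix_map {m n : ℕ} {K : Type*} [Field K] (M : Matrix (Fin m) (Fin n) ℤ)
    (S : Finset (Fin n)) :
    ((colSubmatrix M S).map (Int.cast : ℤ → K)).rank =
      Module.finrank K (Submodule.span K ((M.map (Int.cast : ℤ → K)).col '' (S : Set (Fin n)))) := by
  rw [Matrix.rank_eq_finrank_span_cols, Set.image_eq_range]
  rfl

/-- Removing a column `j` for which some row is zero outside `j` but nonzero over `K` at `j`
lowers the rank over `K` by one. -/
theorem rank_colSubmatrix_eq_rank_erase_add_one {m n : ℕ} {K : Type*} [Field K]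
    (M : Matrix (Fin m) (Fin n) ℤ) {S : Finset (Fin n)} {i : Fin m} {j : Fin n} (hj : j ∈ S)
    (hij : (M i j : K) ≠ 0) (h : ∀ j' ∈ S, j' ≠ j → M i j' = 0) :
    ((colSubmatrix M S).map (Int.cast : ℤ → K)).rank =
      ((colSubmatrix M (S.erase j)).map (Int.cast : ℤ → K)).rank + 1 := by
  have hv : (M.map (Int.cast : ℤ → K)).col j ∉
      Submodule.span K ((M.map (Int.cast : ℤ → K)).col '' (S.erase j : Set (Fin n))) := by
    intro hmem
    have hle : Submodule.span K
        ((M.map (Int.cast : ℤ → K)).col '' (S.erase j : Set (Fin n))) ≤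
          LinearMap.ker (LinearMap.proj i : (Fin m → K) →ₗ[K] K) := by
      rw [Submodule.span_le]
      rintro _ ⟨j', hj', rfl⟩
      obtain ⟨hne, hmem'⟩ := Finset.mem_erase.mp (Finset.mem_coe.mp hj')
      simp [h j' hmem' hne]
    exact hij (by simpa using hle hmem)
  rw [rank_colSubmatrix_map, rank_colSubmatrix_map, ← Submodule.finrank_sup_span_singleton hv,
    ← Submodule.span_union, Set.union_singleton, ← Set.image_insert_eq, ← Finset.coe_insert,
    Finset.insert_erase hj]

/-- If `S` is a minimal torsion cocycle of an integer matrix `M`, then no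
row of `M_S` has exactly one nonzero entry with that entry equal to `1` or `-1`. -/
theorem no_unit_row_of_minimal_torsion_cocycle {m n : ℕ} (M : Matrix (Fin m) (Fin n) ℤ)
    (S : Finset (Fin n)) (hS : IsMinimalTorsionCocycle M S) :
    ¬ ∃ i : Fin m, ∃ j ∈ S, (M i j = 1 ∨ M i j = -1) ∧
        ∀ j' ∈ S, j' ≠ j → M i j' = 0 := by
  rintro ⟨i, j, hj, hunit, hzero⟩
  obtain ⟨⟨q, hq, hlt⟩, hmin⟩ := hS
  have : Fact q.Prime := ⟨hq⟩
  refine hmin (S.erase j) (Finset.erase_ssubset hj) ⟨q, hq, ?_⟩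
  rw [rank_colSubmatrix_eq_rank_erase_add_one M hj (by rcases hunit with h | h <;> simp [h]) hzero,
    rank_colSubmatrix_eq_rank_erase_add_one M hj (by rcases hunit with h | h <;> simp [h]) hzero]
    at hlt
  exact Nat.lt_of_add_lt_add_right hlt
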